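/- Let Z be a weight operator satisfying Condition A(p) for some p ≥ 1. Then for all words α, β with |α| = |β| and every m ≥ 0, the operator S_α* Z^m S_β belongs to the smallest closed star-subalgebra of B(H) containing all compact operators and the set {S_γ Z^l S_δ* : |γ| = |δ|, l ≥ 0}. -/

import Mathlib

noncomputable section

instance (α : Type*) [DecidableEq α] : DecidableEq (FreeMonoid α) :=
  fun a b => inferInstanceAs (Decidable (a.toList = b.toList))

/-- The full Fock space of `ℂ^d`, modeled as `ℓ²` of the free monoid on `Fin d`. -/
abbrev FockSpace (d : ℕ) : Type := lp (fun _ : FreeMonoid (Fin d) => ℂ) 2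

/-- The standard basis vector `e_α` of the Fock space. -/
noncomputable def fockBasis (d : ℕ) (α : FreeMonoid (Fin d)) : FockSpace d :=
  lp.single 2 α (1 : ℂ)

/-- `S_α = S_{α₁} ⋯ S_{αₙ}` for a word `α` (with `S_∅ = 1`). -/
noncomputable def wordOp {d : ℕ} (S : Fin d → (FockSpace d →L[ℂ] FockSpace d))
    (α : FreeMonoid (Fin d)) : FockSpace d →L[ℂ] FockSpace d :=
  (α.toList.map S).prod

/-- Words of equal length on the left can be cancelled from an equality of products. -/
theorem FreeMonoid.mul_eq_mul_iff_of_length_eq {ι : Type*} {α β γ δ : FreeMonoid ι}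
    (h : α.length = β.length) : α * γ = β * δ ↔ α = β ∧ γ = δ :=
  ⟨fun hmul => List.append_inj hmul h, fun ⟨h₁, h₂⟩ => by rw [h₁, h₂]⟩

section CompactOperators

open ContinuousLinearMap InnerProductSpace

variable {E : Type*} [NormedAddCommGroup E] [NormedSpace ℂ E]

theorem IsCompactOperator.mul_left {A : E →L[ℂ] E} (hA : IsCompactOperator A) (B : E →L[ℂ] E) :
    IsCompactOperator ⇑(B * A) :=
  hA.clm_comp B

theorem IsCompactOperator.mul_right {A : E →L[ℂ] E} (hA : IsCompactOperator A) (B : E →L[ℂ] E) :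
    IsCompactOperator ⇑(A * B) :=
  hA.comp_clm B

theorem isCompactOperator_commutator_mul {A B Z : E →L[ℂ] E}
    (hA : IsCompactOperator ⇑(A * Z - Z * A)) (hB : IsCompactOperator ⇑(B * Z - Z * B)) :
    IsCompactOperator ⇑(A * B * Z - Z * (A * B)) := by
  have h : A * B * Z - Z * (A * B) = A * (B * Z - Z * B) + (A * Z - Z * A) * B := by
    noncomm_ring
  rw [h]
  exact (hB.mul_left A).add (hA.mul_right B)

theorem isCompactOperator_commutator_pow {A Z : E →L[ℂ] E}
    (hA : IsCompactOperator ⇑(A * Z - Z * A)) (m : ℕ) :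
    IsCompactOperator ⇑(A * Z ^ m - Z ^ m * A) := by
  induction m with
  | zero =>
    simpa using (isCompactOperator_zero : IsCompactOperator (0 : E → E))
  | succ m ih =>
    have h : A * Z ^ (m + 1) - Z ^ (m + 1) * A
        = (A * Z ^ m - Z ^ m * A) * Z + Z ^ m * (A * Z - Z * A) := by
      rw [pow_succ]
      noncomm_ring
    rw [h]
    exact (ih.mul_right Z).add (hA.mul_left (Z ^ m))

theorem isCompactOperator_rankOne {H : Type*} [NormedAddCommGroup H] [InnerProductSpace ℂ H]
    (x y : H) : IsCompactOperator ⇑(rankOne ℂ x y) := by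
  have h : IsCompactOperator ⇑(innerSL ℂ y) :=
    isCompactOperator_of_locallyCompactSpace_dom (innerSL ℂ y)
  exact h.clm_comp (toSpanSingleton ℂ x)

end CompactOperators

section FockSpace

open ContinuousLinearMap InnerProductSpace

variable {d : ℕ}

theorem inner_fockBasis_left (α : FreeMonoid (Fin d)) (f : FockSpace d) :
    inner ℂ (fockBasis d α) f = f α := by
  simp [fockBasis, lp.inner_single_left]

theorem inner_fockBasis_fockBasis (α β : FreeMonoid (Fin d)) :
    inner ℂ (fockBasis d α) (fockBasis d β) = if α = β then 1 else 0 := by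
  rw [inner_fockBasis_left, fockBasis, lp.single_apply, Pi.single_apply]

theorem FockSpace.ext_inner {f g : FockSpace d}
    (h : ∀ α, inner ℂ (fockBasis d α) f = inner ℂ (fockBasis d α) g) : f = g := by
  ext α
  simpa only [inner_fockBasis_left] using h α

theorem FockSpace.clm_ext {A B : FockSpace d →L[ℂ] FockSpace d}
    (h : ∀ α, A (fockBasis d α) = B (fockBasis d α)) : A = B := by
  have h' : adjoint A = adjoint B := by
    ext1 f
    refine FockSpace.ext_inner fun α => ?_
    rw [adjoint_inner_right, adjoint_inner_right, h]
  simpa using congrArg adjoint h'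

variable {S : Fin d → (FockSpace d →L[ℂ] FockSpace d)}

theorem wordOp_one : wordOp S 1 = 1 := rfl

theorem wordOp_mul (α β : FreeMonoid (Fin d)) :
    wordOp S (α * β) = wordOp S α * wordOp S β := by
  simp [wordOp]

theorem wordOp_of (i : Fin d) : wordOp S (FreeMonoid.of i) = S i := by
  simp [wordOp]

theorem isCompactOperator_wordOp_commutator_of_length {p : ℕ}
    {Z : FockSpace d →L[ℂ] FockSpace d}
    (hAp : ∀ α : FreeMonoid (Fin d), α.length = p →
      IsCompactOperator ⇑(wordOp S α * Z - Z * wordOp S α)) (n : ℕ) :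
    ∀ α : FreeMonoid (Fin d), α.length = n * p →
      IsCompactOperator ⇑(wordOp S α * Z - Z * wordOp S α) := by
  induction n with
  | zero =>
    intro α hα
    rw [zero_mul, FreeMonoid.length_eq_zero] at hα
    subst hα
    simpa [wordOp_one] using
      (isCompactOperator_zero : IsCompactOperator (0 : FockSpace d → FockSpace d))
  | succ n ih =>
    intro α hα
    have hα' : α.toList.length = n * p + p := by rw [← Nat.succ_mul]; exact hα
    have hsplit : α = FreeMonoid.ofList (α.toList.take p) * FreeMonoid.ofList (α.toList.drop p) :=
      (List.take_append_drop p α.toList).symm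
    rw [hsplit, wordOp_mul]
    refine isCompactOperator_commutator_mul (hAp _ ?_) (ih _ ?_)
    · simp [FreeMonoid.length, hα']
    · simp [FreeMonoid.length, hα']

variable (hS : ∀ (i : Fin d) (α : FreeMonoid (Fin d)),
  S i (fockBasis d α) = fockBasis d (FreeMonoid.of i * α))

include hS

theorem wordOp_fockBasis (α β : FreeMonoid (Fin d)) :
    wordOp S α (fockBasis d β) = fockBasis d (α * β) := by
  induction α using FreeMonoid.inductionOn' with
  | one => rw [wordOp_one, one_mul, one_apply_eq_self]
  | of_mul i α ih => rw [wordOp_mul, wordOp_of, mul_apply_eq_comp, ih, hS, mul_assoc]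

theorem adjoint_wordOp_mul_wordOp {α β : FreeMonoid (Fin d)} (h : α.length = β.length) :
    adjoint (wordOp S α) * wordOp S β = if α = β then 1 else 0 := by
  refine FockSpace.clm_ext fun δ => FockSpace.ext_inner fun γ => ?_
  rw [mul_apply_eq_comp, adjoint_inner_right, wordOp_fockBasis hS, wordOp_fockBasis hS,
    inner_fockBasis_fockBasis]
  by_cases hαβ : α = β <;>
    simp [FreeMonoid.mul_eq_mul_iff_of_length_eq h, hαβ, inner_fockBasis_fockBasis]

theorem sum_mul_adjoint_add_rankOne :
    ∑ i, S i * adjoint (S i) + rankOne ℂ (fockBasis d 1) (fockBasis d 1) = 1 := by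
  refine FockSpace.clm_ext fun β => ?_
  rw [add_apply, sum_apply, rankOne_apply, inner_fockBasis_fockBasis, one_apply_eq_self]
  induction β using FreeMonoid.casesOn with
  | one =>
    have h (i : Fin d) : adjoint (S i) (fockBasis d 1) = 0 := by
      refine FockSpace.ext_inner fun α => ?_
      rw [adjoint_inner_right, hS, inner_fockBasis_fockBasis, inner_zero_right, if_neg]
      exact fun h => by simpa using congrArg FreeMonoid.length h
    simp [h]
  | of_mul j β =>
    have h (i : Fin d) : adjoint (S i) (fockBasis d (FreeMonoid.of j * β))
        = if i = j then fockBasis d β else 0 := by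
      have := adjoint_wordOp_mul_wordOp hS (α := FreeMonoid.of i) (β := FreeMonoid.of j) rfl
      rw [wordOp_of, wordOp_of] at this
      rw [← hS, ← mul_apply_eq_comp, this]
      by_cases hij : i = j <;> simp [FreeMonoid.of_injective.eq_iff, hij]
    have hne : (1 : FreeMonoid (Fin d)) ≠ FreeMonoid.of j * β :=
      fun h => by simpa [add_comm 1] using congrArg FreeMonoid.length h
    simp [h, hne, apply_ite, hS]

theorem isCompactOperator_wordOp_mul_adjoint_sub_sum (γ : FreeMonoid (Fin d)) :
    IsCompactOperator ⇑(wordOp S γ * adjoint (wordOp S γ) -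
      ∑ i, wordOp S (γ * FreeMonoid.of i) * adjoint (wordOp S (γ * FreeMonoid.of i))) := by
  have h : wordOp S γ * adjoint (wordOp S γ) -
      ∑ i, wordOp S (γ * FreeMonoid.of i) * adjoint (wordOp S (γ * FreeMonoid.of i))
      = wordOp S γ * rankOne ℂ (fockBasis d 1) (fockBasis d 1) * adjoint (wordOp S γ) := by
    rw [eq_sub_iff_add_eq'.mpr (sum_mul_adjoint_add_rankOne hS)]
    simp only [wordOp_mul, wordOp_of, ← star_eq_adjoint, star_mul, mul_sub, sub_mul, mul_one,
      Finset.mul_sum, Finset.sum_mul, mul_assoc]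
  rw [h]
  exact ((isCompactOperator_rankOne _ _).mul_left _).mul_right _

/-- A star subalgebra containing the compact operators and the operators `S_γ Z^m S_γ*` contains
every `S_α* Z^m S_β S_γ S_γ*` such that `S_{βγ}` can be lengthened to words whose operators
commute with `Z` modulo the compact operators. -/
theorem adjoint_wordOp_mul_pow_mul_mem {Z : FockSpace d →L[ℂ] FockSpace d}
    {A : StarSubalgebra ℂ (FockSpace d →L[ℂ] FockSpace d)}
    (hK : ∀ Y : FockSpace d →L[ℂ] FockSpace d, IsCompactOperator Y → Y ∈ A) (m : ℕ)
    (hA : ∀ γ, wordOp S γ * Z ^ m * adjoint (wordOp S γ) ∈ A) {N : ℕ}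
    (hN : ∀ α : FreeMonoid (Fin d), α.length = N →
      IsCompactOperator ⇑(wordOp S α * Z - Z * wordOp S α))
    {α β : FreeMonoid (Fin d)} (hαβ : α.length = β.length) (r : ℕ) :
    ∀ γ : FreeMonoid (Fin d), (β * γ).length + r = N →
      adjoint (wordOp S α) * Z ^ m * wordOp S β * (wordOp S γ * adjoint (wordOp S γ)) ∈ A := by
  induction r with
  | zero =>
    intro γ hγ
    have hc := (((isCompactOperator_commutator_pow (hN _ hγ) m).mul_left
      (adjoint (wordOp S α))).mul_right (adjoint (wordOp S γ)))
    have h : adjoint (wordOp S α) * Z ^ m * wordOp S β * (wordOp S γ * adjoint (wordOp S γ))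
        = adjoint (wordOp S α) * wordOp S β * (wordOp S γ * Z ^ m * adjoint (wordOp S γ))
          - adjoint (wordOp S α) * (wordOp S (β * γ) * Z ^ m - Z ^ m * wordOp S (β * γ))
            * adjoint (wordOp S γ) := by
      rw [wordOp_mul]
      noncomm_ring
    rw [h, adjoint_wordOp_mul_wordOp hS hαβ]
    refine sub_mem ?_ (hK _ hc)
    split_ifs
    · rw [one_mul]
      exact hA γ
    · rw [zero_mul]
      exact zero_mem A
  | succ r ih =>
    intro γ hγ
    rw [← sub_add_cancel (wordOp S γ * adjoint (wordOp S γ))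
      (∑ i, wordOp S (γ * FreeMonoid.of i) * adjoint (wordOp S (γ * FreeMonoid.of i))),
      mul_add, Finset.mul_sum]
    refine add_mem (hK _ ((isCompactOperator_wordOp_mul_adjoint_sub_sum hS γ).mul_left _))
      (sum_mem fun i _ => ih _ ?_)
    rw [← mul_assoc, FreeMonoid.length_mul, FreeMonoid.length_of]
    omega

end FockSpace

open ContinuousLinearMap in
theorem statement9 (d : ℕ) (hd : 1 ≤ d)
    (S : Fin d → (FockSpace d →L[ℂ] FockSpace d))
    (hS : ∀ (i : Fin d) (α : FreeMonoid (Fin d)),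
      S i (fockBasis d α) = fockBasis d (FreeMonoid.of i * α))
    (P : ℕ → (FockSpace d →L[ℂ] FockSpace d))
    (hP : ∀ (k : ℕ) (α : FreeMonoid (Fin d)),
      P k (fockBasis d α) = if α.length = k then fockBasis d α else 0)
    (Z : FockSpace d →L[ℂ] FockSpace d)
    (hZinv : IsUnit Z)
    (hZP : ∀ k : ℕ, Z * P k = P k * Z)
    (hZ0 : Z * P 0 = P 0)
    (p : ℕ) (hp : 1 ≤ p)
    (hAp : ∀ α : FreeMonoid (Fin d), α.length = p →
      IsCompactOperator ⇑(wordOp S α * Z - Z * wordOp S α)) :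
    ∀ (α β : FreeMonoid (Fin d)) (m : ℕ), α.length = β.length →
      adjoint (wordOp S α) * Z ^ m * wordOp S β ∈
        (StarAlgebra.adjoin ℂ
          ({Y : FockSpace d →L[ℂ] FockSpace d | IsCompactOperator ⇑Y} ∪
            {x | ∃ (γ δ : FreeMonoid (Fin d)) (l : ℕ), γ.length = δ.length ∧
              x = wordOp S γ * Z ^ l * adjoint (wordOp S δ)})).topologicalClosure := by
  intro α β m hαβ
  refine StarSubalgebra.le_topologicalClosure _ ?_
  have hr : (β * 1).length + β.length * (p - 1) = β.length * p := by
    obtain ⟨q, rfl⟩ := Nat.exists_eq_add_of_le hp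
    rw [mul_one, Nat.add_sub_cancel_left]
    ring
  rw [← mul_one (adjoint (wordOp S α) * Z ^ m * wordOp S β),
    ← show wordOp S 1 * adjoint (wordOp S 1) = 1 by simp [wordOp_one, ← star_eq_adjoint]]
  exact adjoint_wordOp_mul_pow_mul_mem hS
    (fun Y hY => StarAlgebra.subset_adjoin ℂ _ (Or.inl hY)) m
    (fun γ => StarAlgebra.subset_adjoin ℂ _ (Or.inr ⟨γ, γ, m, rfl, rfl⟩))
    (isCompactOperator_wordOp_commutator_of_length hAp β.length) hαβ _ 1 hr
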